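/- Let K be a simplicial complex with metric d. For every ε > 0 and every natural number m ≥ 1 there exists a continuous map F : K → [0,1]^{m-1} such that for every p ∈ [0,1]^{m-1}, Widim_ε(F^{-1}(p), d) ≤ (dim K)/m. -/

import Mathlib

open scoped ENNReal

noncomputable section

/-- The `n`-th Bowen metric of the system `(X, T, d)`:
`dₙ(x,y) = max_{0 ≤ i < n} d(Tⁱ x, Tⁱ y)`. -/
def bowen {X : Type*} [PseudoMetricSpace X] (T : X → X) (n : ℕ) (x y : X) : ℝ :=
  ⨆ i : Fin n, dist (T^[i] x) (T^[i] y)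

/-- Gromov's `ε`-width dimension `Widim_ε(A, d)` of a subset `A` with respect to a
(pseudo-)metric `d`: the smallest `k` such that there is a continuous map from `A`
into (the space of) some `k`-dimensional simplicial complex all of whose fibers have
`d`-diameter `< ε`. -/
def widim {X : Type*} [TopologicalSpace X] (d : X → X → ℝ) (ε : ℝ) (A : Set X) : ℕ :=
  sInf {k : ℕ | ∃ (m : ℕ) (K : Geometry.SimplicialComplex ℝ (Fin m → ℝ))
      (f : A → (Fin m → ℝ)), Continuous f ∧ (∀ a, f a ∈ K.space) ∧
      (∀ s ∈ K.faces, s.card ≤ k + 1) ∧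
      ∀ a b : A, f a = f b → d a b < ε}

/-- Mean topological dimension `mdim(X,T) = lim_{ε→0} lim_n Widim_ε(X,dₙ)/n`
(the inner limit exists and equals the infimum by subadditivity; the outer limit is the
supremum over `ε > 0` by monotonicity). -/
def mdim {X : Type*} [PseudoMetricSpace X] (T : X → X) : ℝ≥0∞ :=
  ⨆ (ε : ℝ) (_ : 0 < ε), ⨅ n : ℕ,
    (widim (bowen T (n + 1)) ε (Set.univ : Set X) : ℝ≥0∞) / (n + 1)

/-- Upper mean dimension of a subset `A ⊆ X`:
`lim_{ε→0} limsup_n Widim_ε(A, dₙ)/n`. -/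
def mdimSup {X : Type*} [PseudoMetricSpace X] (T : X → X) (A : Set X) : ℝ≥0∞ :=
  ⨆ (ε : ℝ) (_ : 0 < ε), Filter.atTop.limsup fun n : ℕ =>
    (widim (bowen T n) ε A : ℝ≥0∞) / n

/-- The (simplicial) dimension of a simplicial complex: the largest `d` such that
`K` has a face with `d + 1` vertices. -/
def scDim {m : ℕ} (K : Geometry.SimplicialComplex ℝ (Fin m → ℝ)) : ℕ :=
  sSup {d : ℕ | ∃ s ∈ K.faces, s.card = d + 1}

lemma single_affineIndependent (k : ℕ) :
    AffineIndependent ℝ (Subtype.val :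
      (Set.range fun i : Fin k => (Pi.single i (1 : ℝ) : Fin k → ℝ)) → (Fin k → ℝ)) := by
  have h : LinearIndependent ℝ (fun i : Fin k => (Pi.single i (1 : ℝ) : Fin k → ℝ)) := by
    have h := (Pi.basisFun ℝ (Fin k)).linearIndependent
    have e : (⇑(Pi.basisFun ℝ (Fin k))) = fun i => (Pi.single i (1 : ℝ) : Fin k → ℝ) := by
      funext i
      exact Pi.basisFun_apply ℝ (Fin k) i
    rwa [e] at h
  exact h.affineIndependent.range

/-- The `q`-skeleton of the standard simplex. -/
def skel (k q : ℕ) : Geometry.SimplicialComplex ℝ (Fin k → ℝ) where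
  faces := {s | s.Nonempty ∧
    (s : Set (Fin k → ℝ)) ⊆ Set.range (fun i : Fin k => (Pi.single i (1 : ℝ) : Fin k → ℝ)) ∧
    s.card ≤ q + 1}
  isRelLowerSet_faces := by
    intro s hs
    refine ⟨hs.1, fun t hts ht => ⟨ht, ?_, ?_⟩⟩
    · exact (Finset.coe_subset.2 hts).trans hs.2.1
    · exact (Finset.card_le_card hts).trans hs.2.2
  indep := by
    intro s hs
    exact (single_affineIndependent k).mono hs.2.1
  inter_subset_convexHull := by
    intro s t hs ht
    classical
    rw [AffineIndependent.convexHull_inter (R := ℝ) (s := s ∪ t)]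
    · apply (single_affineIndependent k).mono
      simp only [Finset.coe_union]
      exact Set.union_subset hs.2.1 ht.2.1
    · exact Finset.subset_union_left
    · exact Finset.subset_union_right

lemma widim_le_fin {X : Type*} [PseudoMetricSpace X] {ε : ℝ} (A : Set X) (k q : ℕ)
    (φ : Fin k → X → ℝ) (hc : ∀ v, Continuous (φ v)) (h0 : ∀ v x, 0 ≤ φ v x)
    (c : Fin k → ℕ) (hcq : ∀ v, c v ≤ q)
    (hcov : ∀ x ∈ A, ∃ v, 0 < φ v x)
    (hinj : ∀ x ∈ A, ∀ v w, 0 < φ v x → 0 < φ w x → c v = c w → v = w)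
    (hd : ∀ x ∈ A, ∀ y ∈ A, ∀ v, 0 < φ v x → 0 < φ v y → dist x y < ε) :
    widim dist ε A ≤ q := by
  classical
  have hpos : ∀ x ∈ A, 0 < ∑ v, φ v x := by
    intro x hx
    obtain ⟨v, hv⟩ := hcov x hx
    exact Finset.sum_pos' (fun v _ => h0 v x) ⟨v, Finset.mem_univ _, hv⟩
  apply Nat.sInf_le
  refine ⟨k, skel k q, fun a v => φ v a / ∑ w, φ w a, ?_, ?_, fun s hs => hs.2.2, ?_⟩
  · refine continuous_pi fun v => Continuous.div₀ ?_ ?_ ?_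
    · exact (hc v).comp continuous_subtype_val
    · exact continuous_finsetSum _ fun w _ => (hc w).comp continuous_subtype_val
    · intro a; exact (hpos a a.2).ne'
  · rintro ⟨a, ha⟩
    rw [Geometry.SimplicialComplex.mem_space_iff]
    let T : Finset (Fin k) := Finset.univ.filter fun v => 0 < φ v a
    refine ⟨T.image (fun i => (Pi.single i (1 : ℝ) : Fin k → ℝ)), ⟨?_, ?_, ?_⟩, ?_⟩
    · obtain ⟨v, hv⟩ := hcov a ha
      exact ⟨_, Finset.mem_image_of_mem _ (by simpa [T] using hv : v ∈ T)⟩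
    · simp
    · refine Finset.card_image_le.trans ?_
      have : T.card ≤ (Finset.range (q + 1)).card := by
        apply Finset.card_le_card_of_injOn c
        · intro v _
          simpa [Nat.lt_succ_iff] using hcq v
        · intro v hv w hw h
          exact hinj a ha v w (by simpa [T] using hv) (by simpa [T] using hw) h
      simpa using this
    · have hsum : ∑ v ∈ T, φ v a = ∑ v, φ v a := by
        apply Finset.sum_subset (Finset.subset_univ _)
        intro v _ hv
        have : ¬ 0 < φ v a := by simpa [T] using hv
        exact le_antisymm (not_lt.1 this) (h0 v a)
      have key : (fun v => φ v a / ∑ w, φ w a) =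
          ∑ v ∈ T, (φ v a / ∑ w, φ w a) • (Pi.single v (1 : ℝ) : Fin k → ℝ) := by
        funext u
        simp only [Finset.sum_apply, Pi.smul_apply, Pi.single_apply, smul_eq_mul, mul_ite,
          mul_one, mul_zero, Finset.sum_ite_eq]
        split_ifs with h
        · rfl
        · have : ¬ 0 < φ u a := by simpa [T] using h
          rw [le_antisymm (not_lt.1 this) (h0 u a), zero_div]
      change (fun v => φ v a / ∑ w, φ w a) ∈ _
      rw [key]
      apply (convex_convexHull ℝ _).sum_mem
      · intro v _
        exact div_nonneg (h0 v a) (hpos a ha).le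
      · rw [← Finset.sum_div, hsum, div_self (hpos a ha).ne']
      · intro v hv
        exact subset_convexHull ℝ _ (Finset.mem_coe.2 (Finset.mem_image_of_mem _ hv))
  · rintro ⟨a, ha⟩ ⟨b, hb⟩ hab
    obtain ⟨v, hv⟩ := hcov a ha
    refine hd a ha b hb v hv ?_
    have h1 : φ v a / ∑ w, φ w a = φ v b / ∑ w, φ w b := congrFun hab v
    have h2 : 0 < φ v b / ∑ w, φ w b := h1 ▸ div_pos hv (hpos a ha)
    by_contra h
    rw [le_antisymm (not_lt.1 h) (h0 v b), zero_div] at h2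
    exact lt_irrefl _ h2

lemma widim_le_fintype {X : Type*} [PseudoMetricSpace X] {ε : ℝ} (A : Set X) (V : Type*)
    [Fintype V] (q : ℕ)
    (φ : V → X → ℝ) (hc : ∀ v, Continuous (φ v)) (h0 : ∀ v x, 0 ≤ φ v x)
    (c : V → ℕ) (hcq : ∀ v, c v ≤ q)
    (hcov : ∀ x ∈ A, ∃ v, 0 < φ v x)
    (hinj : ∀ x ∈ A, ∀ v w, 0 < φ v x → 0 < φ w x → c v = c w → v = w)
    (hd : ∀ x ∈ A, ∀ y ∈ A, ∀ v, 0 < φ v x → 0 < φ v y → dist x y < ε) :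
    widim dist ε A ≤ q := by
  let e := Fintype.equivFin V
  refine widim_le_fin A (Fintype.card V) q (fun i => φ (e.symm i)) (fun i => hc _)
    (fun i => h0 _) (fun i => c (e.symm i)) (fun i => hcq _) ?_ ?_ ?_
  · intro x hx
    obtain ⟨v, hv⟩ := hcov x hx
    exact ⟨e v, by simpa using hv⟩
  · intro x hx v w hv hw h
    exact e.symm.injective (hinj x hx _ _ hv hw h)
  · intro x hx y hy v
    exact hd x hx y hy _

lemma card_le_scDim {N : ℕ} (K : Geometry.SimplicialComplex ℝ (Fin N → ℝ))
    (hK : K.faces.Finite) {s : Finset (Fin N → ℝ)} (hs : s ∈ K.faces) :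
    s.card ≤ scDim K + 1 := by
  have hb : BddAbove {d : ℕ | ∃ s ∈ K.faces, s.card = d + 1} := by
    obtain ⟨M, hM⟩ := (hK.image Finset.card).bddAbove
    refine ⟨M, ?_⟩
    rintro d ⟨s, hs, h⟩
    have := hM (Set.mem_image_of_mem _ hs)
    omega
  have hpos := Finset.card_pos.2 (K.nonempty_of_mem_faces hs)
  have : s.card - 1 ≤ scDim K := le_csSup hb ⟨s, hs, by omega⟩
  omega

/-- A generic translate of the grid avoids the bad position for one face. -/
lemma bad_null {N : ℕ} (s : Finset (Fin N → ℝ)) (hs : s.Nonempty) (I : Finset (Fin N))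
    (hI : s.card ≤ I.card) (u : Fin N → ℝ) :
    MeasureTheory.volume {t : Fin N → ℝ | ∃ x ∈ convexHull ℝ (s : Set (Fin N → ℝ)),
      ∀ i ∈ I, x i = t i + u i} = 0 := by
  classical
  let π : (Fin N → ℝ) →ₗ[ℝ] (I → ℝ) := LinearMap.funLeft ℝ ℝ (fun i : I => (i : Fin N))
  have hπ : ∀ x i, π x i = x i := fun x i => rfl
  let P : AffineSubspace ℝ (I → ℝ) := (affineSpan ℝ (s : Set (Fin N → ℝ))).map π.toAffineMap
  have hP : P ≠ ⊤ := by
    intro h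
    have h1 : P = affineSpan ℝ ((s.image π : Finset (I → ℝ)) : Set (I → ℝ)) := by
      simp only [P, AffineSubspace.map_span, Finset.coe_image]
      rfl
    have h2 : vectorSpan ℝ ((s.image π : Finset (I → ℝ)) : Set (I → ℝ)) = ⊤ := by
      rw [← direction_affineSpan, ← h1, h, AffineSubspace.direction_top]
    have hpos := Finset.card_pos.2 hs
    have h3 := finrank_vectorSpan_image_finset_le ℝ π s (n := s.card - 1) (by omega)
    rw [h2, finrank_top, Module.finrank_fintype_fun_eq_card, Fintype.card_coe] at h3
    omega
  let A : (Fin N → ℝ) →ᵃ[ℝ] (I → ℝ) := π.toAffineMap + AffineMap.const ℝ _ (π u)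
  have hA : ∀ t i, A t i = t i + u i := fun t i => rfl
  have hQ : P.comap A ≠ ⊤ := by
    intro h
    apply hP
    rw [eq_top_iff]
    intro z _
    let t : Fin N → ℝ := fun i => if h : i ∈ I then z ⟨i, h⟩ - u i else 0
    have ht : t ∈ P.comap A := by rw [h]; exact AffineSubspace.mem_top _ _ _
    have : A t = z := by
      funext i
      rw [hA]
      simp [t]
    rw [AffineSubspace.mem_comap, this] at ht
    exact ht
  refine MeasureTheory.measure_mono_null ?_
    (MeasureTheory.Measure.addHaar_affineSubspace MeasureTheory.volume _ hQ)
  rintro t ⟨x, hx, hxt⟩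
  refine ⟨x, convexHull_subset_affineSpan _ hx, ?_⟩
  funext i
  exact hxt i i.2

lemma exists_generic {N : ℕ} (K : Geometry.SimplicialComplex ℝ (Fin N → ℝ))
    (hK : K.faces.Finite) (ε : ℝ) :
    ∃ t : Fin N → ℝ, ∀ x ∈ K.space, ∀ (I : Finset (Fin N)) (k : Fin N → ℤ),
      (∀ i ∈ I, x i = t i + ε * k i) → I.card ≤ scDim K := by
  have hnull : MeasureTheory.volume (⋃ s ∈ K.faces, ⋃ (I : Finset (Fin N)),
      ⋃ (_ : scDim K + 1 ≤ I.card), ⋃ (k : Fin N → ℤ),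
      {t : Fin N → ℝ | ∃ x ∈ convexHull ℝ (s : Set (Fin N → ℝ)),
        ∀ i ∈ I, x i = t i + ε * k i}) = 0 := by
    refine (MeasureTheory.measure_biUnion_null_iff hK.countable).2 fun s hs => ?_
    refine MeasureTheory.measure_iUnion_null fun I => ?_
    refine MeasureTheory.measure_iUnion_null fun hI => ?_
    refine MeasureTheory.measure_iUnion_null fun k => ?_
    exact bad_null s (K.nonempty_of_mem_faces hs) I ((card_le_scDim K hK hs).trans hI)
      (fun i => ε * k i)
  have hne : (MeasureTheory.volume : MeasureTheory.Measure (Fin N → ℝ)) ≠ 0 :=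
    NeZero.ne _
  obtain ⟨t, ht⟩ : ∃ t, t ∉ (⋃ s ∈ K.faces, ⋃ (I : Finset (Fin N)),
      ⋃ (_ : scDim K + 1 ≤ I.card), ⋃ (k : Fin N → ℤ),
      {t : Fin N → ℝ | ∃ x ∈ convexHull ℝ (s : Set (Fin N → ℝ)),
        ∀ i ∈ I, x i = t i + ε * k i}) := by
    by_contra! h
    rw [Set.eq_univ_of_forall h, MeasureTheory.Measure.measure_univ_eq_zero] at hnull
    exact hne hnull
  refine ⟨t, fun x hx I k hxk => ?_⟩
  by_contra! hlt
  obtain ⟨s, hs, hxs⟩ := Geometry.SimplicialComplex.mem_space_iff.1 hx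
  apply ht
  simp only [Set.mem_iUnion]
  exact ⟨s, hs, I, hlt, k, x, hxs, hxk⟩

/-- One coordinate of the bump: `true`-type coordinates are near the grid. -/
def aFun (y : ℝ) (k : ℤ) : ℝ := min (y - k) (k + 1 - y)

open Classical in
/-- Bump function for the cell `(S, k)`. -/
def bump {N : ℕ} (S : Finset (Fin N)) (k : Fin N → ℤ) (y : Fin N → ℝ) : ℝ :=
  max 0 ((insert none (Finset.univ.image some) : Finset (Option (Fin N))).inf'
      (Finset.insert_nonempty _ _)
      (fun o => o.elim (1 / 2 : ℝ) fun r => if r ∈ S then 1 / 2 else aFun (y r) (k r))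
    - (insert none (Finset.univ.image some) : Finset (Option (Fin N))).sup'
      (Finset.insert_nonempty _ _)
      (fun o => o.elim (0 : ℝ) fun r => if r ∈ S then |y r - k r| else 0))

lemma bump_nonneg {N : ℕ} (S : Finset (Fin N)) (k : Fin N → ℤ) (y : Fin N → ℝ) :
    0 ≤ bump S k y := le_max_left _ _

lemma bump_continuous {N : ℕ} (S : Finset (Fin N)) (k : Fin N → ℤ) :
    Continuous (bump S k) := by
  unfold bump
  refine continuous_const.max (Continuous.sub ?_ ?_)
  · refine Continuous.finset_inf'_apply _ fun o _ => ?_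
    cases o with
    | none => exact continuous_const
    | some r =>
      simp only [Option.elim]
      split_ifs
      · exact continuous_const
      · unfold aFun; fun_prop
  · refine Continuous.finset_sup'_apply _ fun o _ => ?_
    cases o with
    | none => exact continuous_const
    | some r =>
      simp only [Option.elim]
      split_ifs
      · fun_prop
      · exact continuous_const

lemma bump_pos_iff {N : ℕ} (S : Finset (Fin N)) (k : Fin N → ℤ) (y : Fin N → ℝ) :
    0 < bump S k y ↔ (∀ s ∈ S, |y s - k s| < 1 / 2) ∧ (∀ r ∉ S, 0 < aFun (y r) (k r)) ∧
      ∀ s ∈ S, ∀ r ∉ S, |y s - k s| < aFun (y r) (k r) := by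
  classical
  unfold bump
  rw [lt_max_iff, sub_pos, Finset.sup'_lt_iff]
  simp only [lt_irrefl, false_or, Finset.lt_inf'_iff]
  constructor
  · intro h
    have hm : ∀ o : Option (Fin N),
        o ∈ (insert none (Finset.univ.image some) : Finset (Option (Fin N))) := by
      intro o; cases o <;> simp
    refine ⟨fun s hs => ?_, fun r hr => ?_, fun s hs r hr => ?_⟩
    · simpa [hs] using h (some s) (hm _) none (hm _)
    · simpa [hr] using h none (hm _) (some r) (hm _)
    · simpa [hs, hr] using h (some s) (hm _) (some r) (hm _)
  · rintro ⟨h1, h2, h3⟩ o _ o' _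
    cases o with
    | none =>
      cases o' with
      | none => simp
      | some r =>
        by_cases hr : r ∈ S
        · simp [hr]
        · simpa [hr] using h2 r hr
    | some s =>
      by_cases hs : s ∈ S
      · cases o' with
        | none => simpa [hs] using h1 s hs
        | some r =>
          by_cases hr : r ∈ S
          · simpa [hr, hs] using h1 s hs
          · simpa [hr, hs] using h3 s hs r hr
      · cases o' with
        | none => simp [hs]
        | some r =>
          by_cases hr : r ∈ S
          · simp [hr, hs]
          · simpa [hr, hs] using h2 r hr

lemma near_unique {y : ℝ} {k l : ℤ} (hk : |y - k| < 1 / 2) (hl : |y - l| < 1 / 2) : k = l := by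
  rw [abs_lt] at hk hl
  have h1 : (k : ℝ) < l + 1 := by linarith
  have h2 : (l : ℝ) < k + 1 := by linarith
  have h1' : k < l + 1 := by exact_mod_cast h1
  have h2' : l < k + 1 := by exact_mod_cast h2
  omega

lemma aFun_unique {y : ℝ} {k l : ℤ} (hk : 0 < aFun y k) (hl : 0 < aFun y l) : k = l := by
  unfold aFun at hk hl
  rw [lt_min_iff] at hk hl
  have h1 : (k : ℝ) < l + 1 := by linarith
  have h2 : (l : ℝ) < k + 1 := by linarith
  have h1' : k < l + 1 := by exact_mod_cast h1
  have h2' : l < k + 1 := by exact_mod_cast h2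
  omega

/-- `aFun` is a lower bound for the distance to any integer. -/
lemma aFun_le {y : ℝ} (k l : ℤ) : aFun y k ≤ |y - l| := by
  unfold aFun
  rcases le_or_gt l k with h | h
  · have h' : (l : ℝ) ≤ k := by exact_mod_cast h
    exact (min_le_left _ _).trans ((by linarith : y - k ≤ y - l).trans (le_abs_self _))
  · have h' : (k : ℝ) + 1 ≤ l := by exact_mod_cast h
    refine (min_le_right _ _).trans ?_
    rw [abs_sub_comm]
    exact (by linarith : (k : ℝ) + 1 - y ≤ l - y).trans (le_abs_self _)

lemma bump_unique {N : ℕ} {S S' : Finset (Fin N)} {k k' : Fin N → ℤ} {y : Fin N → ℝ}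
    (h : 0 < bump S k y) (h' : 0 < bump S' k' y) (hc : S.card = S'.card) : S = S' ∧ k = k' := by
  rw [bump_pos_iff] at h h'
  obtain ⟨h1, h2, h3⟩ := h
  obtain ⟨h1', h2', h3'⟩ := h'
  have hS : S = S' := by
    by_contra hne
    have hn1 : ¬ S ⊆ S' := fun hs => hne (Finset.eq_of_subset_of_card_le hs hc.ge)
    have hn2 : ¬ S' ⊆ S := fun hs => hne (Finset.eq_of_subset_of_card_le hs hc.le).symm
    obtain ⟨a, ha, ha'⟩ := Finset.not_subset.1 hn1
    obtain ⟨b, hb, hb'⟩ := Finset.not_subset.1 hn2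
    have e1 := h3 a ha b hb'
    have e2 := h3' b hb a ha'
    have e3 := aFun_le (y := y b) (k b) (k' b)
    have e4 := aFun_le (y := y a) (k' a) (k a)
    linarith
  subst hS
  refine ⟨rfl, ?_⟩
  funext i
  by_cases hi : i ∈ S
  · exact near_unique (h1 i hi) (h1' i hi)
  · exact aFun_unique (h2 i hi) (h2' i hi)

lemma bump_diam {N : ℕ} {S : Finset (Fin N)} {k : Fin N → ℤ} {y z : Fin N → ℝ}
    (h : 0 < bump S k y) (h' : 0 < bump S k z) (i : Fin N) : |y i - z i| < 1 := by
  rw [bump_pos_iff] at h h'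
  obtain ⟨h1, h2, -⟩ := h
  obtain ⟨h1', h2', -⟩ := h'
  by_cases hi : i ∈ S
  · have e1 := abs_lt.1 (h1 i hi)
    have e2 := abs_lt.1 (h1' i hi)
    rw [abs_lt]; constructor <;> linarith
  · have e1 := h2 i hi
    have e2 := h2' i hi
    unfold aFun at e1 e2
    rw [lt_min_iff] at e1 e2
    rw [abs_lt]; constructor <;> linarith

open Classical in
lemma bump_cover {N : ℕ} (y : Fin N → ℝ) :
    0 < bump (Finset.univ.filter fun i => y i = ⌊y i⌋) (fun i => ⌊y i⌋) y := by
  rw [bump_pos_iff]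
  have ha : ∀ r, y r ≠ ⌊y r⌋ → 0 < aFun (y r) ⌊y r⌋ := by
    intro r hr
    have e1 := Int.floor_le (y r)
    have e2 := Int.lt_floor_add_one (y r)
    have e3 := lt_of_le_of_ne e1 (Ne.symm hr)
    unfold aFun
    rw [lt_min_iff]; constructor <;> linarith
  refine ⟨fun s hs => ?_, fun r hr => ha r (by simpa using hr), fun s hs r hr => ?_⟩
  · have hs' : y s = ⌊y s⌋ := by simpa using hs
    rw [← hs']; norm_num
  · have hs' : y s = ⌊y s⌋ := by simpa using hs
    rw [← hs', sub_self, abs_zero]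
    exact ha r (by simpa using hr)

/-- Tsukamoto's variation of Gromov's lemma: for a (finite) simplicial
complex `K` with metric `d`, any `ε > 0` and `m ≥ 1`, there is a continuous map
`F : K → [0,1]^{m-1}` with `Widim_ε(F⁻¹(p), d) ≤ (dim K)/m` for every `p`. -/
theorem stmt8 {N : ℕ} (K : Geometry.SimplicialComplex ℝ (Fin N → ℝ))
    (hK : K.faces.Finite) {ε : ℝ} (hε : 0 < ε) (m : ℕ) (hm : 1 ≤ m) :
    ∃ F : (Fin N → ℝ) → (Fin (m - 1) → ℝ), Continuous F ∧
      (∀ x ∈ K.space, ∀ i, F x i ∈ Set.Icc (0 : ℝ) 1) ∧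
      ∀ p : Fin (m - 1) → ℝ,
        (widim dist ε (K.space ∩ F ⁻¹' {p}) : ℝ) ≤ (scDim K : ℝ) / m := by
  classical
  obtain ⟨t, ht⟩ := exists_generic K hK ε
  set n := scDim K with hn
  set q := n / m with hq
  let Y : (Fin N → ℝ) → (Fin N → ℝ) := fun x i => (x i - t i) / ε
  have hY : Continuous Y := by
    refine continuous_pi fun i => ?_
    fun_prop
  -- boundedness
  have hcomp : IsCompact K.space := by
    refine hK.isCompact_biUnion fun s _ => ?_
    exact s.finite_toSet.isCompact_convexHull (𝕜 := ℝ)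
  obtain ⟨R, hR⟩ := (hcomp.image hY).isBounded.exists_norm_le
  obtain ⟨M, hM⟩ := exists_nat_gt R
  let W : Finset (Finset (Fin N) × (Fin N → ℤ)) :=
    (Finset.univ.filter fun S => S.card ≤ n) ×ˢ
      Fintype.piFinset fun _ => Finset.Icc (-(M : ℤ) - 1) M
  let φ : W → (Fin N → ℝ) → ℝ := fun v x => bump v.1.1 v.1.2 (Y x)
  have hφc : ∀ v, Continuous (φ v) := fun v => (bump_continuous _ _).comp hY
  have hφ0 : ∀ v x, 0 ≤ φ v x := fun v x => bump_nonneg _ _ _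
  have hWcard : ∀ v : W, v.1.1.card ≤ n := by
    intro v
    have := v.2
    simp only [W, Finset.mem_product, Finset.mem_filter] at this
    exact this.1.2
  have hcov : ∀ x ∈ K.space, ∃ v, 0 < φ v x := by
    intro x hx
    refine ⟨⟨(Finset.univ.filter fun i => Y x i = ⌊Y x i⌋, fun i => ⌊Y x i⌋), ?_⟩,
      bump_cover (Y x)⟩
    simp only [W, Finset.mem_product, Finset.mem_filter, Finset.mem_univ, true_and,
      Fintype.mem_piFinset, Finset.mem_Icc]
    constructor
    · refine ht x hx _ (fun i => ⌊Y x i⌋) fun i hi => ?_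
      have hi' : Y x i = ⌊Y x i⌋ := by simpa using hi
      rw [← hi']
      simp only [Y]
      field_simp
      ring
    · intro i
      have h1 : |Y x i| ≤ R :=
        (norm_le_pi_norm (Y x) i).trans (hR _ (Set.mem_image_of_mem _ hx))
      have h2 := abs_le.1 h1
      constructor
      · rw [Int.le_floor]; push_cast; linarith
      · have : ((⌊Y x i⌋ : ℤ) : ℝ) ≤ (M : ℤ) := by
          push_cast; linarith [Int.floor_le (Y x i)]
        exact_mod_cast this
  have hdist : ∀ v x y, 0 < φ v x → 0 < φ v y → dist x y < ε := by
    intro v x y hx hy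
    rw [dist_pi_lt_iff hε]
    intro i
    have h := bump_diam hx hy i
    have e : Y x i - Y y i = (x i - y i) / ε := by simp only [Y]; ring
    rw [e, abs_div, abs_of_pos hε, div_lt_one hε] at h
    rwa [Real.dist_eq]
  have hinj : ∀ (v w : W) x, 0 < φ v x → 0 < φ w x → v.1.1.card = w.1.1.card → v = w := by
    intro v w x hv hw h
    obtain ⟨h1, h2⟩ := bump_unique hv hw h
    exact Subtype.ext (Prod.ext h1 h2)
  let g : W → ℕ := fun v => v.1.1.card / (q + 1)
  have hg : ∀ v, g v < m := by
    intro v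
    have h1 := hWcard v
    have h2 : n < m * (q + 1) := by
      have := Nat.lt_mul_div_succ n (by omega : 0 < m)
      simpa [hq] using this
    exact (Nat.div_lt_iff_lt_mul (Nat.succ_pos q)).2 (lt_of_le_of_lt h1 h2)
  -- the key estimate on a set where the `j`-th group is active
  have key : ∀ (A : Set (Fin N → ℝ)) (j : ℕ),
      (∀ x ∈ A, ∃ v, g v = j ∧ 0 < φ v x) → widim dist ε A ≤ q := by
    intro A j hA
    refine widim_le_fintype A {v : W // g v = j} q (fun v => φ v.1) (fun v => hφc _)
      (fun v => hφ0 _) (fun v => v.1.1.1.card % (q + 1))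
      (fun v => Nat.lt_succ_iff.1 (Nat.mod_lt _ (Nat.succ_pos q))) ?_ ?_ ?_
    · intro x hx
      obtain ⟨v, h1, h2⟩ := hA x hx
      exact ⟨⟨v, h1⟩, h2⟩
    · rintro x hx ⟨v, hv'⟩ ⟨w, hw'⟩ hv hw h
      apply Subtype.ext
      refine hinj v w x hv hw ?_
      have e1 := Nat.div_add_mod v.1.1.card (q + 1)
      have e2 := Nat.div_add_mod w.1.1.card (q + 1)
      have e3 : v.1.1.card / (q + 1) = w.1.1.card / (q + 1) := hv'.trans hw'.symm
      have e4 : v.1.1.card % (q + 1) = w.1.1.card % (q + 1) := h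
      rw [← e1, ← e2, e3, e4]
    · intro x _ y _ v hx hy
      exact hdist _ x y hx hy
  refine ⟨fun x j => min 1 (∑ v : W, if g v = j then φ v x else 0), ?_, ?_, ?_⟩
  · refine continuous_pi fun j => continuous_const.min ?_
    refine continuous_finsetSum _ fun v _ => ?_
    split_ifs
    · exact hφc v
    · exact continuous_const
  · intro x _ j
    refine ⟨le_min zero_le_one (Finset.sum_nonneg fun v _ => ?_), min_le_left _ _⟩
    split_ifs
    · exact hφ0 v x
    · exact le_rfl
  · intro p
    have hle : ∀ k : ℕ, k ≤ q → (k : ℝ) ≤ (n : ℝ) / m := by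
      intro k hk
      exact (Nat.cast_le.2 hk).trans Nat.cast_div_le
    apply hle
    by_cases hp : ∃ j, p j ≠ 0
    · obtain ⟨j, hj⟩ := hp
      apply key _ (j : ℕ)
      rintro x ⟨_, hx⟩
      by_contra! hno
      apply hj
      have hx' := congrFun (Set.mem_singleton_iff.1 hx) j
      rw [← hx']
      have : (∑ v : W, if g v = (j : ℕ) then φ v x else 0) = 0 := by
        refine Finset.sum_eq_zero fun v _ => ?_
        split_ifs with h
        · exact le_antisymm (hno v h) (hφ0 v x)
        · rfl
      simp only [this]
      norm_num
    · push Not at hp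
      apply key _ (m - 1)
      rintro x ⟨hxK, hx⟩
      obtain ⟨v, hv⟩ := hcov x hxK
      refine ⟨v, ?_, hv⟩
      by_contra hne
      have hlt : g v < m - 1 := by have := hg v; omega
      have hx' := congrFun (Set.mem_singleton_iff.1 hx) ⟨g v, hlt⟩
      rw [hp] at hx'
      have hpos : 0 < ∑ w : W, if g w = g v then φ w x else 0 := by
        refine Finset.sum_pos' (fun w _ => ?_) ⟨v, Finset.mem_univ _, by simpa using hv⟩
        split_ifs
        · exact hφ0 w x
        · exact le_rfl
      exact (lt_min one_pos hpos).ne' hx'
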